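/- For every integer n ≥ 3 and every vertex u ∈ V, the probability of the event E_{1,u} — that there exists a four-cycle rooted at u whose edge sequence pattern (writing s for a local edge and w for a long-range edge) is (s,s,s,w) or (w,s,s,s) — satisfies Pr(E_{1,u}) < (2/3) · ln(n/2)^{−1}. -/

import Mathlib

open scoped Classical
open Finset

/-- Vertex set of the `n × n` torus. -/
abbrev Vx (n : ℕ) := Fin n × Fin n

/-- Toroidal distance on the `n × n` torus. -/
def tdist (n : ℕ) (u v : Vx n) : ℕ :=
  min ((u.1 : ℤ) - (v.1 : ℤ)).natAbs (n - ((u.1 : ℤ) - (v.1 : ℤ)).natAbs) +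
  min ((u.2 : ℤ) - (v.2 : ℤ)).natAbs (n - ((u.2 : ℤ) - (v.2 : ℤ)).natAbs)

/-- The normalizing factor at vertex `u`. -/
noncomputable def Zfac (n : ℕ) (u : Vx n) : ℝ :=
  (∑ w ∈ univ.filter (fun w => w ≠ u), ((tdist n u w : ℝ) ^ 2)⁻¹)⁻¹

/-- The probability mass of the outcome `c : V → V` (the vector of long-range choices)
under the UTSW product measure: each vertex `u` independently chooses `c u = v ≠ u`
with probability `Z · d(u,v)⁻²`. -/
noncomputable def mass (n : ℕ) (c : Vx n → Vx n) : ℝ :=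
  ∏ u : Vx n, if c u = u then 0 else Zfac n u * ((tdist n u (c u) : ℝ) ^ 2)⁻¹

/-- Probability of an event under the UTSW product measure. -/
noncomputable def Pr (n : ℕ) (E : Set (Vx n → Vx n)) : ℝ :=
  ∑ c : Vx n → Vx n, if c ∈ E then mass n c else 0

/-- `{x, y}` is an edge of the UTSW random graph `G(c)`. -/
def isEdge (n : ℕ) (c : Vx n → Vx n) (x y : Vx n) : Prop :=
  x ≠ y ∧ (tdist n x y = 1 ∨ c x = y ∨ c y = x)

/-- `{x, y}` is an edge of `G(c)` of the given kind: local (`w = false`, distance one)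
or long-range (`w = true`, distance not one). -/
def edgeKind (n : ℕ) (c : Vx n → Vx n) (x y : Vx n) (w : Bool) : Prop :=
  isEdge n c x y ∧ (tdist n x y = 1 ↔ w = false)

/-- There is a four-cycle rooted at `u` in `G(c)` whose edge sequence has the local/long-range
pattern `(p₁, p₂, p₃, p₄)` (`false` = local edge, `true` = long-range edge). -/
def cyclePat (n : ℕ) (c : Vx n → Vx n) (u : Vx n) (p₁ p₂ p₃ p₄ : Bool) : Prop :=
  ∃ a b e : Vx n, a ≠ b ∧ a ≠ e ∧ b ≠ e ∧ a ≠ u ∧ b ≠ u ∧ e ≠ u ∧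
    edgeKind n c u a p₁ ∧ edgeKind n c a b p₂ ∧ edgeKind n c b e p₃ ∧ edgeKind n c e u p₄

/-- `ζ(3) = ∑_{i ≥ 1} i⁻³`. -/
noncomputable def zeta3 : ℝ := ∑' i : ℕ, ((i + 1 : ℝ) ^ 3)⁻¹

/-- The distance from `i` to the nearest multiple of `n`. -/
def cyclicAbs (n : ℕ) (i : ℤ) : ℕ := min (i % n).toNat (n - (i % n).toNat)

/-- Translation of a residue by an integer. -/
def cyclicShift {n : ℕ} (x : Fin n) (i : ℤ) : Fin n :=
  ⟨((x + i) % n).toNat, by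
    have := Int.emod_lt_of_pos ((x : ℤ) + i) (by have := x.pos; omega : (0 : ℤ) < n)
    have := x.pos
    omega⟩

/-- Translation of a vertex of the torus by an integer vector. -/
def torusShift {n : ℕ} (u : Vx n) (δ : ℤ × ℤ) : Vx n := (cyclicShift u.1 δ.1, cyclicShift u.2 δ.2)

lemma cyclicShift_modEq {n : ℕ} (x : Fin n) (i : ℤ) :
    (cyclicShift x i : ℤ) ≡ x + i [ZMOD n] := by
  have h := Int.emod_nonneg ((x : ℤ) + i) (by have := x.pos; omega : (n : ℤ) ≠ 0)
  simp only [cyclicShift, Int.toNat_of_nonneg h]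
  exact Int.mod_modEq _ _

lemma eq_of_modEq {n : ℕ} {x y : Fin n} (h : (x : ℤ) ≡ y [ZMOD n]) : x = y := by
  have hx := x.isLt
  have hy := y.isLt
  rw [Int.ModEq, Int.emod_eq_of_lt (by omega) (by omega), Int.emod_eq_of_lt (by omega) (by omega)]
    at h
  exact Fin.ext (by exact_mod_cast h)

lemma eq_cyclicShift {n : ℕ} {x y : Fin n} {i : ℤ} (h : (y : ℤ) ≡ x + i [ZMOD n]) :
    y = cyclicShift x i :=
  eq_of_modEq (h.trans (cyclicShift_modEq x i).symm)

lemma cyclicAbs_of_modEq {n : ℕ} {x y : Fin n} {i : ℤ} (h : (y : ℤ) ≡ x + i [ZMOD n]) :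
    min ((x : ℤ) - (y : ℤ)).natAbs (n - ((x : ℤ) - (y : ℤ)).natAbs) = cyclicAbs n i := by
  have hx := x.isLt
  have hy := y.isLt
  have hi : i % n = ((y : ℤ) - x) % n := by
    have := (h.sub_right (x : ℤ)).symm
    simpa [Int.ModEq] using this
  unfold cyclicAbs
  rw [hi]
  rcases le_or_gt (x : ℤ) y with hxy | hxy
  · rw [Int.emod_eq_of_lt (by omega) (by omega)]
    omega
  · have : ((y : ℤ) - x) % n = y - x + n := by
      rw [← Int.add_emod_right, Int.emod_eq_of_lt (by omega) (by omega)]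
    rw [this]
    omega

lemma tdist_torusShift {n : ℕ} (u : Vx n) (δ : ℤ × ℤ) :
    tdist n u (torusShift u δ) = cyclicAbs n δ.1 + cyclicAbs n δ.2 := by
  exact congrArg₂ (· + ·) (cyclicAbs_of_modEq (cyclicShift_modEq u.1 δ.1))
    (cyclicAbs_of_modEq (cyclicShift_modEq u.2 δ.2))

lemma tdist_comm (n : ℕ) (u v : Vx n) : tdist n u v = tdist n v u := by
  unfold tdist
  rw [← Int.natAbs_neg ((u.1 : ℤ) - v.1), ← Int.natAbs_neg ((u.2 : ℤ) - v.2), neg_sub, neg_sub]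

lemma cyclicAbs_eq_natAbs_of_le {n : ℕ} {i : ℤ} (h0 : 0 < n) (h : 2 * i.natAbs ≤ n) :
    cyclicAbs n i = i.natAbs := by
  unfold cyclicAbs
  rcases le_or_gt 0 i with hi | hi
  · rw [Int.emod_eq_of_lt (by omega) (by omega)]
    omega
  · rw [← Int.add_emod_right, Int.emod_eq_of_lt (by omega) (by omega)]
    omega

lemma cyclicAbs_eq_natAbs {n : ℕ} {i : ℤ} (h : 2 * i.natAbs < n) : cyclicAbs n i = i.natAbs :=
  cyclicAbs_eq_natAbs_of_le (by omega) h.le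

lemma tdist_ne_zero {n : ℕ} {u v : Vx n} (h : u ≠ v) : tdist n u v ≠ 0 := by
  intro h0
  apply h
  have h1 := u.1.isLt
  have h2 := u.2.isLt
  have h3 := v.1.isLt
  have h4 := v.2.isLt
  unfold tdist at h0
  ext <;> omega

lemma exists_unit_step {n : ℕ} {u v : Vx n} (h : tdist n u v = 1) :
    ∃ i j : ℤ, i.natAbs + j.natAbs = 1 ∧
      (v.1 : ℤ) ≡ u.1 + i [ZMOD n] ∧ (v.2 : ℤ) ≡ u.2 + j [ZMOD n] := by
  have key : ∀ x y : Fin n, ∀ k : ℕ, k ≤ 1 →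
      min ((x : ℤ) - (y : ℤ)).natAbs (n - ((x : ℤ) - (y : ℤ)).natAbs) = k →
      ∃ i : ℤ, i.natAbs = k ∧ (y : ℤ) ≡ x + i [ZMOD n] := by
    intro x y k hk hxy
    have hx := x.isLt
    have hy := y.isLt
    have : ((x : ℤ) - y).natAbs = k ∨ ((x : ℤ) - y).natAbs = n - k := by omega
    rcases this with h | h
    · exact ⟨y - x, by omega, by simp⟩
    · rcases le_or_gt (x : ℤ) y with hle | hlt
      · refine ⟨y - x - n, by omega, ?_⟩
        rw [Int.modEq_iff_dvd]
        exact ⟨-1, by ring⟩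
      · refine ⟨y - x + n, by omega, ?_⟩
        rw [Int.modEq_iff_dvd]
        exact ⟨1, by ring⟩
  unfold tdist at h
  obtain ⟨i, hi, hi'⟩ := key u.1 v.1 _ (by omega) rfl
  obtain ⟨j, hj, hj'⟩ := key u.2 v.2 _ (by omega) rfl
  exact ⟨i, j, by omega, hi', hj'⟩

/-- The integer vectors of `ℓ¹`-norm three. -/
def normThree : Fin 12 → ℤ × ℤ :=
  ![(3, 0), (-3, 0), (0, 3), (0, -3), (2, 1), (2, -1), (-2, 1), (-2, -1),
    (1, 2), (1, -2), (-1, 2), (-1, -2)]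

lemma exists_normThree {i j : ℤ} (h : i.natAbs + j.natAbs = 3) : ∃ k, normThree k = (i, j) := by
  have hi : -3 ≤ i ∧ i ≤ 3 := by omega
  obtain ⟨hi1, hi2⟩ := hi
  have hj : -3 ≤ j ∧ j ≤ 3 := by omega
  obtain ⟨hj1, hj2⟩ := hj
  interval_cases i <;> interval_cases j <;> first | (exfalso; revert h; decide) | (clear h; decide)

lemma natAbs_add_three_unit_steps {i₁ i₂ i₃ j₁ j₂ j₃ : ℤ} (h₁ : i₁.natAbs + j₁.natAbs = 1)
    (h₂ : i₂.natAbs + j₂.natAbs = 1) (h₃ : i₃.natAbs + j₃.natAbs = 1) :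
    (i₁ + i₂ + i₃).natAbs + (j₁ + j₂ + j₃).natAbs = 1 ∨
      (i₁ + i₂ + i₃).natAbs + (j₁ + j₂ + j₃).natAbs = 3 := by
  have unit : ∀ i j : ℤ, i.natAbs + j.natAbs = 1 →
      (i = 0 ∧ (j = 1 ∨ j = -1)) ∨ (j = 0 ∧ (i = 1 ∨ i = -1)) := by
    intro i j h
    omega
  rcases unit _ _ h₁ with ⟨rfl, rfl | rfl⟩ | ⟨rfl, rfl | rfl⟩ <;>
  rcases unit _ _ h₂ with ⟨rfl, rfl | rfl⟩ | ⟨rfl, rfl | rfl⟩ <;>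
  rcases unit _ _ h₃ with ⟨rfl, rfl | rfl⟩ | ⟨rfl, rfl | rfl⟩ <;> decide

lemma exists_torusShift_of_path {n : ℕ} (hn : 3 ≤ n) {u a b e : Vx n} (h1 : tdist n u a = 1)
    (h2 : tdist n a b = 1) (h3 : tdist n b e = 1) (h4 : tdist n u e ≠ 1) :
    ∃ k, e = torusShift u (normThree k) := by
  obtain ⟨i1, j1, s1, x1, y1⟩ := exists_unit_step h1
  obtain ⟨i2, j2, s2, x2, y2⟩ := exists_unit_step h2
  obtain ⟨i3, j3, s3, x3, y3⟩ := exists_unit_step h3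
  have hx : (e.1 : ℤ) ≡ u.1 + (i1 + i2 + i3) [ZMOD n] := by
    have := x3.trans (((x2.trans (x1.add_right i2))).add_right i3)
    convert this using 1; ring
  have hy : (e.2 : ℤ) ≡ u.2 + (j1 + j2 + j3) [ZMOD n] := by
    have := y3.trans (((y2.trans (y1.add_right j2))).add_right j3)
    convert this using 1; ring
  generalize hI : i1 + i2 + i3 = I at hx
  generalize hJ : j1 + j2 + j3 = J at hy
  have he : e = torusShift u (I, J) := Prod.ext (eq_cyclicShift hx) (eq_cyclicShift hy)
  have hor : I.natAbs + J.natAbs = 1 ∨ I.natAbs + J.natAbs = 3 :=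
    hI ▸ hJ ▸ natAbs_add_three_unit_steps s1 s2 s3
  rcases hor with h | h
  · rw [he, tdist_torusShift, cyclicAbs_eq_natAbs (by simp only; omega),
      cyclicAbs_eq_natAbs (by simp only; omega)] at h4
    exact absurd h h4
  · obtain ⟨k, hk⟩ := exists_normThree h
    exact ⟨k, by rw [hk, he]⟩

/-- The probability that `u` chooses `v`. -/
noncomputable def choiceProb (n : ℕ) (u v : Vx n) : ℝ :=
  if v = u then 0 else Zfac n u * ((tdist n u v : ℝ) ^ 2)⁻¹

lemma Zfac_nonneg (n : ℕ) (u : Vx n) : 0 ≤ Zfac n u :=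
  inv_nonneg.2 (Finset.sum_nonneg fun _ _ => by positivity)

lemma choiceProb_nonneg (n : ℕ) (u v : Vx n) : 0 ≤ choiceProb n u v := by
  have := Zfac_nonneg n u
  unfold choiceProb
  split_ifs <;> positivity

lemma sum_choiceProb_le_one (n : ℕ) (u : Vx n) : ∑ v, choiceProb n u v ≤ 1 := by
  have : ∑ v, choiceProb n u v
      = Zfac n u * ∑ w ∈ univ.filter (fun w => w ≠ u), ((tdist n u w : ℝ) ^ 2)⁻¹ := by
    rw [Finset.mul_sum, Finset.sum_filter]
    refine Finset.sum_congr rfl fun v _ => ?_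
    by_cases h : v = u <;> simp [choiceProb, h]
  rw [this, Zfac]
  exact inv_mul_le_one

lemma mass_eq_prod (n : ℕ) (c : Vx n → Vx n) : mass n c = ∏ u, choiceProb n u (c u) := rfl

lemma mass_nonneg (n : ℕ) (c : Vx n → Vx n) : 0 ≤ mass n c := by
  rw [mass_eq_prod]
  exact Finset.prod_nonneg fun _ _ => choiceProb_nonneg _ _ _

lemma Pr_choice_le (n : ℕ) (u v : Vx n) : Pr n {c | c u = v} ≤ choiceProb n u v := by
  let f : Vx n → Vx n → ℝ := fun x y => if x = u ∧ y ≠ v then 0 else choiceProb n x y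
  have hf : ∀ x y, 0 ≤ f x y := fun x y => by
    have := choiceProb_nonneg n x y
    simp only [f]
    split_ifs <;> simp [this]
  have hPr : Pr n {c | c u = v} = ∏ x, ∑ y, f x y := by
    rw [Finset.prod_univ_sum, Fintype.piFinset_univ]
    refine Finset.sum_congr rfl fun c _ => ?_
    by_cases h : c u = v
    · simp only [Set.mem_ofPred_eq, h, if_true, mass_eq_prod]
      refine Finset.prod_congr rfl fun x _ => ?_
      have : ¬ (x = u ∧ c x ≠ v) := by rintro ⟨rfl, h'⟩; exact h' h
      simp only [f, if_neg this]
    · simp only [Set.mem_ofPred_eq, h, if_false]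
      refine (Finset.prod_eq_zero (Finset.mem_univ u) ?_).symm
      simp [f, h]
  have hu : ∑ y, f u y = choiceProb n u v := by
    rw [Finset.sum_eq_single v]
    · simp [f]
    · intro y _ hy
      simp [f, hy]
    · simp
  rw [hPr, ← Finset.mul_prod_erase _ _ (Finset.mem_univ u), hu]
  refine mul_le_of_le_one_right (choiceProb_nonneg _ _ _) (Finset.prod_le_one ?_ ?_)
  · exact fun x _ => Finset.sum_nonneg fun y _ => hf x y
  · intro x hx
    have hxu : x ≠ u := Finset.ne_of_mem_erase hx
    simpa [f, hxu] using sum_choiceProb_le_one n x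

lemma Pr_le_sum {n : ℕ} {ι : Type*} [Fintype ι] {E : Set (Vx n → Vx n)}
    (A : ι → Set (Vx n → Vx n)) (h : E ⊆ ⋃ k, A k) : Pr n E ≤ ∑ k, Pr n (A k) := by
  unfold Pr
  rw [Finset.sum_comm]
  refine Finset.sum_le_sum fun c _ => ?_
  have h0 : ∀ k, 0 ≤ if c ∈ A k then mass n c else 0 := fun k => by
    split_ifs <;> simp [mass_nonneg]
  by_cases hc : c ∈ E
  · obtain ⟨k, hk⟩ := Set.mem_iUnion.1 (h hc)
    rw [if_pos hc]
    calc mass n c = if c ∈ A k then mass n c else 0 := by rw [if_pos hk]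
      _ ≤ _ := Finset.single_le_sum (f := fun k => if c ∈ A k then mass n c else 0)
        (fun k _ => h0 k) (Finset.mem_univ k)
  · rw [if_neg hc]
    exact Finset.sum_nonneg fun k _ => h0 k

/-- The vector of norm `k` at offset `t < k` along the `r`-th side of the `ℓ¹`-sphere. -/
def sphereVec (k t : ℕ) (r : Fin 4) : ℤ × ℤ :=
  ![((k : ℤ) - t, (t : ℤ)), (-(t : ℤ), (k : ℤ) - t), (-((k : ℤ) - t), -(t : ℤ)),
    ((t : ℤ), -((k : ℤ) - t))] r

lemma natAbs_sphereVec {k t : ℕ} (h : t < k) (r : Fin 4) :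
    (sphereVec k t r).1.natAbs + (sphereVec k t r).2.natAbs = k := by
  fin_cases r <;> simp [sphereVec] <;> omega

lemma sphereVec_injective {k t k' t' : ℕ} {r r' : Fin 4} (h : t < k) (h' : t' < k')
    (heq : sphereVec k t r = sphereVec k' t' r') : k = k' ∧ t = t' ∧ r = r' := by
  fin_cases r <;> fin_cases r' <;> simp [sphereVec] at heq ⊢ <;> omega

lemma cyclicShift_injOn {n : ℕ} {x : Fin n} {i j : ℤ} (h : (i - j).natAbs < n)
    (heq : cyclicShift x i = cyclicShift x j) : i = j := by
  have h1 := cyclicShift_modEq x i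
  rw [heq] at h1
  have h2 := (Int.ModEq.add_left_cancel' _ (h1.symm.trans (cyclicShift_modEq x j)))
  have h3 := Int.eq_zero_of_dvd_of_natAbs_lt_natAbs h2.dvd (by omega)
  omega

lemma harmonic_le_sum_tdist {n m : ℕ} (hm : 2 * m < n) (u : Vx n) :
    4 * (harmonic m : ℝ) ≤ ∑ w ∈ univ.filter (fun w => w ≠ u), ((tdist n u w : ℝ) ^ 2)⁻¹ := by
  let P : Finset (Σ _ : ℕ, ℕ × Fin 4) :=
    (Finset.range m).sigma fun k => Finset.range (k + 1) ×ˢ univ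
  let φ : (Σ _ : ℕ, ℕ × Fin 4) → Vx n := fun p => torusShift u (sphereVec (p.1 + 1) p.2.1 p.2.2)
  have hP : ∀ p ∈ P, p.1 < m ∧ p.2.1 < p.1 + 1 := by
    intro p hp
    simpa [P] using hp
  have hd : ∀ p ∈ P, tdist n u (φ p) = p.1 + 1 := by
    intro p hp
    obtain ⟨h1, h2⟩ := hP p hp
    have h3 := natAbs_sphereVec h2 p.2.2
    simp only [φ]
    rw [tdist_torusShift, cyclicAbs_eq_natAbs (by omega), cyclicAbs_eq_natAbs (by omega), h3]
  have hinj : Set.InjOn φ P := by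
    rintro ⟨k, t, r⟩ hp ⟨k', t', r'⟩ hp' heq
    obtain ⟨h1, h2⟩ := hP _ hp
    obtain ⟨h1', h2'⟩ := hP _ hp'
    have h3 := natAbs_sphereVec h2 r
    have h3' := natAbs_sphereVec h2' r'
    simp only [φ, torusShift, Prod.mk.injEq] at heq h1 h2 h3 h1' h2' h3'
    obtain ⟨e1, e2, e3⟩ := sphereVec_injective h2 h2' (Prod.ext
      (cyclicShift_injOn (by omega) heq.1) (cyclicShift_injOn (by omega) heq.2))
    obtain rfl : k = k' := by omega
    subst e2 e3
    rfl
  have hsum : 4 * (harmonic m : ℝ) = ∑ p ∈ P, ((tdist n u (φ p) : ℝ) ^ 2)⁻¹ := by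
    rw [Finset.sum_congr rfl fun p hp => by rw [hd p hp], Finset.sum_sigma, harmonic]
    push_cast
    rw [Finset.mul_sum]
    refine Finset.sum_congr rfl fun k _ => ?_
    simp only [Finset.sum_const, Finset.card_product, Finset.card_range, Finset.card_univ,
      Fintype.card_fin, nsmul_eq_mul]
    push_cast
    field_simp
  rw [hsum, ← Finset.sum_image (f := fun w => ((tdist n u w : ℝ) ^ 2)⁻¹) hinj]
  refine Finset.sum_le_sum_of_subset_of_nonneg ?_ fun _ _ _ => by positivity
  intro w hw
  obtain ⟨p, hp, rfl⟩ := Finset.mem_image.1 hw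
  refine Finset.mem_filter.2 ⟨Finset.mem_univ _, fun h => ?_⟩
  have := hd p hp
  rw [h] at this
  simp [tdist] at this

/-- The inverse square distance of the translate by `δ`, when this translate is not a
neighbour. -/
noncomputable def farWeight (n : ℕ) (δ : ℤ × ℤ) : ℝ :=
  if 2 ≤ cyclicAbs n δ.1 + cyclicAbs n δ.2 then
    (((cyclicAbs n δ.1 + cyclicAbs n δ.2 : ℕ) : ℝ) ^ 2)⁻¹ else 0

lemma Pr_le_farWeight {n : ℕ} (hn : 3 ≤ n) {L : ℝ} (hL : 0 < L)
    (hS : ∀ v : Vx n, L ≤ ∑ w ∈ univ.filter (fun w => w ≠ v), ((tdist n v w : ℝ) ^ 2)⁻¹)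
    (u : Vx n) :
    Pr n {c | cyclePat n c u false false false true ∨ cyclePat n c u true false false false} ≤
      2 * L⁻¹ * ∑ k, farWeight n (normThree k) := by
  let e : Fin 12 → Vx n := fun k => torusShift u (normThree k)
  have hZ : ∀ v : Vx n, Zfac n v ≤ L⁻¹ := fun v => inv_anti₀ hL (hS v)
  have hp : ∀ v w : Vx n, choiceProb n v w ≤ L⁻¹ * ((tdist n v w : ℝ) ^ 2)⁻¹ := by
    intro v w
    unfold choiceProb
    split_ifs
    · positivity
    · exact mul_le_mul_of_nonneg_right (hZ v) (by positivity)
  let A : Fin 12 × Bool → Set (Vx n → Vx n) := fun p =>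
    if 2 ≤ tdist n u (e p.1) then
      if p.2 then {c | c u = e p.1} else {c | c (e p.1) = u}
    else ∅
  have hfar : ∀ {c : Vx n → Vx n} {a b w : Vx n}, tdist n u a = 1 → tdist n a b = 1 →
      tdist n b w = 1 → tdist n u w ≠ 1 → w ≠ u → (c u = w ∨ c w = u) → c ∈ ⋃ p, A p := by
    intro c a b w h1 h2 h3 h4 h5 h6
    obtain ⟨k, rfl⟩ := exists_torusShift_of_path hn h1 h2 h3 h4
    have h7 := tdist_ne_zero h5.symm
    have h8 : 2 ≤ tdist n u (e k) := by simp only [e]; omega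
    rcases h6 with h6 | h6
    · exact Set.mem_iUnion.2 ⟨(k, true), by simpa [A, h8] using h6⟩
    · exact Set.mem_iUnion.2 ⟨(k, false), by simpa [A, h8] using h6⟩
  refine (Pr_le_sum A ?_).trans ?_
  · rintro c (⟨a, b, w, -, -, -, -, -, hwu, h1, h2, h3, h4⟩ |
      ⟨w, b, a, -, -, -, hwu, -, -, h4, h3, h2, h1⟩)
    · have h5 : tdist n w u ≠ 1 := by simpa using h4.2
      refine hfar (h1.2.2 rfl) (h2.2.2 rfl) (h3.2.2 rfl) (by rwa [tdist_comm]) hwu ?_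
      have := h4.1.2
      tauto
    · have h5 : tdist n u w ≠ 1 := by simpa using h4.2
      refine hfar (a := a) (b := b) ?_ ?_ ?_ h5 hwu ?_
      · rw [tdist_comm]; exact h1.2.2 rfl
      · rw [tdist_comm]; exact h2.2.2 rfl
      · rw [tdist_comm]; exact h3.2.2 rfl
      · have := h4.1.2
        tauto
  · rw [Fintype.sum_prod_type, Finset.mul_sum]
    refine Finset.sum_le_sum fun k _ => ?_
    rw [Fintype.sum_bool, farWeight, ← tdist_torusShift u (normThree k)]
    change _ ≤ 2 * L⁻¹ * if 2 ≤ tdist n u (e k) then ((tdist n u (e k) : ℝ) ^ 2)⁻¹ else 0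
    by_cases h : 2 ≤ tdist n u (e k)
    · have h1 := (Pr_choice_le n u (e k)).trans (hp _ _)
      have h2 := (Pr_choice_le n (e k) u).trans (hp _ _)
      rw [tdist_comm] at h2
      simp only [A, h, if_true, Bool.false_eq_true, if_false]
      linarith
    · simp [A, h, Pr]

lemma sum_farWeight_three : ∑ k, farWeight 3 (normThree k) = 2 := by
  simp [Fin.sum_univ_succ, normThree, farWeight, cyclicAbs]
  norm_num

lemma sum_farWeight_five : ∑ k, farWeight 5 (normThree k) = 17 / 9 := by
  simp [Fin.sum_univ_succ, normThree, farWeight, cyclicAbs]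
  norm_num

lemma sum_farWeight_le {n : ℕ} (hn : 4 ≤ n) (h5 : n ≠ 5) :
    ∑ k, farWeight n (normThree k) ≤ 4 / 3 := by
  have h : ∀ k, farWeight n (normThree k) ≤ 1 / 9 := by
    intro k
    have key : cyclicAbs n (normThree k).1 + cyclicAbs n (normThree k).2 ≤ 1 ∨
        cyclicAbs n (normThree k).1 + cyclicAbs n (normThree k).2 = 3 := by
      rcases Nat.lt_or_ge n 6 with h6 | h6
      · obtain rfl : n = 4 := by omega
        revert k
        decide
      · have : (normThree k).1.natAbs + (normThree k).2.natAbs = 3 := by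
          revert k
          decide
        rw [cyclicAbs_eq_natAbs_of_le (by omega) (by omega),
          cyclicAbs_eq_natAbs_of_le (by omega) (by omega)]
        omega
    unfold farWeight
    rcases key with h | h
    · rw [if_neg (by omega)]
      norm_num
    · rw [h]
      norm_num
  refine (Finset.sum_le_sum fun k _ => h k).trans ?_
  norm_num

lemma log_lt_harmonic {m : ℕ} (hm : 0 < m) : Real.log (m + 1) < harmonic m := by
  have := Real.strictMono_eulerMascheroniSeq hm
  rw [Real.eulerMascheroniSeq_zero, Real.eulerMascheroniSeq] at this
  linarith

/-- Probability bound for the event `E1ᵤ`. -/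
theorem prob_E1 :
    ∀ n : ℕ, 3 ≤ n → ∀ u : Vx n,
      Pr n {c | cyclePat n c u false false false true ∨ cyclePat n c u true false false false} <
        (2 / 3) * (Real.log ((n : ℝ) / 2))⁻¹ := by
  intro n hn u
  obtain ⟨m, hm, hm1, hm2⟩ : ∃ m, 2 * m < n ∧ 0 < m ∧ n ≤ 2 * m + 2 :=
    ⟨(n - 1) / 2, by omega, by omega, by omega⟩
  have hn3 : (3 : ℝ) ≤ n := by exact_mod_cast hn
  have hlog : 0 < Real.log ((n : ℝ) / 2) := Real.log_pos (by linarith)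
  have hH : Real.log ((n : ℝ) / 2) < harmonic m := by
    refine lt_of_le_of_lt (Real.log_le_log (by linarith) ?_) (log_lt_harmonic hm1)
    have : (n : ℝ) ≤ 2 * m + 2 := by exact_mod_cast hm2
    linarith
  have hHpos : (0 : ℝ) < harmonic m := hlog.trans hH
  refine (Pr_le_farWeight hn (by positivity) (harmonic_le_sum_tdist hm) u).trans_lt ?_
  rw [← div_eq_mul_inv (2 / 3 : ℝ), lt_div_iff₀ hlog]
  by_cases h3 : n = 3
  · subst h3
    obtain rfl : m = 1 := by omega
    have := Real.log_le_sub_one_of_pos (by norm_num : (0 : ℝ) < ((3 : ℕ) : ℝ) / 2)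
    rw [sum_farWeight_three]
    norm_num [harmonic, Finset.sum_range_succ] at this ⊢
    linarith
  by_cases h5 : n = 5
  · subst h5
    obtain rfl : m = 2 := by omega
    have : Real.log (((5 : ℕ) : ℝ) / 2) < 1 := by
      rw [Real.log_lt_iff_lt_exp (by norm_num)]
      have := Real.exp_one_gt_d9
      norm_num at this ⊢
      linarith
    rw [sum_farWeight_five]
    norm_num [harmonic, Finset.sum_range_succ] at this ⊢
    linarith
  have hW := sum_farWeight_le (by omega : 4 ≤ n) h5
  calc 2 * (4 * (harmonic m : ℝ))⁻¹ * (∑ k, farWeight n (normThree k)) * Real.log ((n : ℝ) / 2)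
      ≤ 2 * (4 * (harmonic m : ℝ))⁻¹ * (4 / 3) * Real.log ((n : ℝ) / 2) := by gcongr
    _ = (2 / 3) * (Real.log ((n : ℝ) / 2) / harmonic m) := by field_simp
    _ < 2 / 3 := by
      have := (div_lt_one hHpos).2 hH
      linarith
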